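/- (Monotonicity with respect to the environment.) Let ω₁, ω₂ ∈ Ω₊ with ω₁(x,i) ≤ ω₂(x,i) for all x ∈ ℤ and i ≥ 1, let −∞ ≤ x ≤ y ≤ z ≤ ∞ with y ∈ ℤ, and let t ∈ ℕ ∪ {∞}. Then P_{y,ω₁}[T_z ≤ T_x ∧ t] ≤ P_{y,ω₂}[T_z ≤ T_x ∧ t], where by convention T_∞ = T_{−∞} = ∞. -/

import Mathlib

open MeasureTheory Filter Set Topology ProbabilityTheory
open scoped ENNReal ENat

noncomputable section

/-- A cookie environment: `ω z i` is the strength of the `(i+1)`-st cookie at site `z`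
(cookies at each site are indexed by `i = 0, 1, 2, …`). -/
abbrev CEnv : Type := ℤ → ℕ → ℝ

/-- `ω` belongs to `Ω₊`, i.e. all cookie strengths lie in `[1/2, 1]`. -/
def IsCookieEnv (ω : CEnv) : Prop := ∀ z i, ω z i ∈ Set.Icc (1/2 : ℝ) 1

/-- The number of visits of the path `x` to the site `x n` at times `m < n`. -/
def prevVisits (x : ℕ → ℤ) (n : ℕ) : ℕ :=
  ((Finset.range n).filter fun m => x m = x n).card

/-- The probability of the step from `x n` to `x (n+1)` for the multi-excited random
walk: jump to the right with the strength of the bottom remaining cookie at the current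
site, to the left with the complementary probability. -/
def stepProb (ω : CEnv) (x : ℕ → ℤ) (n : ℕ) : ℝ :=
  if x (n+1) = x n + 1 then ω (x n) (prevVisits x n)
  else if x (n+1) = x n - 1 then 1 - ω (x n) (prevVisits x n)
  else 0

/-- The probability that the walk started at `x0` follows the path `x` up to time `n`. -/
def cylProb (ω : CEnv) (x0 : ℤ) (x : ℕ → ℤ) (n : ℕ) : ℝ :=
  (if x 0 = x0 then 1 else 0) * ∏ m ∈ Finset.range n, stepProb ω x m

/-- `P` is the law `P_{x0,ω}` of the multi-excited random walk in the cookie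
environment `ω` started at `x0`, characterized by its cylinder probabilities. -/
def IsERWLaw (ω : CEnv) (x0 : ℤ) (P : Measure (ℕ → ℤ)) : Prop :=
  IsProbabilityMeasure P ∧
    ∀ (x : ℕ → ℤ) (n : ℕ),
      P {Y | ∀ m ≤ n, Y m = x m} = ENNReal.ofReal (cylProb ω x0 x n)

/-- First passage time `T_k`, with value `∞` if `k` is never visited. -/
def T (k : ℤ) (Y : ℕ → ℤ) : ℕ∞ :=
  sInf {t : ℕ∞ | ∃ n : ℕ, (n : ℕ∞) = t ∧ Y n = k}

/-- First passage time of an extended-real level, with the convention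
`T_{−∞} = T_{+∞} = ∞`. -/
def Te (k : EReal) (Y : ℕ → ℤ) : ℕ∞ :=
  sInf {t : ℕ∞ | ∃ n : ℕ, (n : ℕ∞) = t ∧ ((Y n : ℝ) : EReal) = k}

/-- `R_k`, the event that the site `k` is visited infinitely often. -/
def Rset (k : ℤ) : Set (ℕ → ℤ) := {Y | ∀ N : ℕ, ∃ n ≥ N, Y n = k}

/-- The number of visits of `Y` to the site `s` at times `< t`. -/
def visitsBefore (Y : ℕ → ℤ) (s : ℤ) (t : ℕ∞) : ℕ∞ :=
  {m : ℕ | (m : ℕ∞) < t ∧ Y m = s}.encard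

/-- `D_t^s`: the total drift stored in the cookies consumed at the site `s`
before time `t` (a time in `ℕ∞`; `t = ∞` gives `D_∞^s`). -/
def driftAt (ω : CEnv) (Y : ℕ → ℤ) (s : ℤ) (t : ℕ∞) : ℝ≥0∞ :=
  ∑' i : ℕ, Set.indicator {i : ℕ | (i : ℕ∞) < visitsBefore Y s t}
    (fun i => ENNReal.ofReal (2 * ω s i - 1)) i

/-- `D_t`: the total drift consumed before time `t` (at all sites). -/
def Dtot (ω : CEnv) (Y : ℕ → ℤ) (t : ℕ∞) : ℝ≥0∞ := ∑' s : ℤ, driftAt ω Y s t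

/-- `D_t^+`: the total drift consumed at nonnegative sites before time `t`. -/
def DtotPos (ω : CEnv) (Y : ℕ → ℤ) (t : ℕ∞) : ℝ≥0∞ := ∑' s : ℕ, driftAt ω Y (s : ℤ) t

/-- `δ^s`: the total drift stored in the cookies at the site `s`. -/
def cookieDrift (ω : CEnv) (s : ℤ) : ℝ≥0∞ := ∑' i : ℕ, ENNReal.ofReal (2 * ω s i - 1)

/-- The successive times `τ_{k,1}, τ_{k,2}, …` (indexed here from `0`) at which the
walk is at a site `≥ k`. -/
def tauT (k : ℤ) (Y : ℕ → ℤ) : ℕ → ℕ∞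
  | 0 => sInf {t : ℕ∞ | ∃ n : ℕ, (n : ℕ∞) = t ∧ k ≤ Y n}
  | m + 1 => sInf {t : ℕ∞ | ∃ n : ℕ, (n : ℕ∞) = t ∧ tauT k Y m < (n : ℕ∞) ∧ k ≤ Y n}

/-- The observed sequence `(X_{τ_{k,m}})_{m ≥ 1}` (indexed here from `0`). -/
def obsSeq (k : ℤ) (Y : ℕ → ℤ) (m : ℕ) : ℤ := Y (tauT k Y m).toNat

/-- The one-sided shift on sequences. -/
def shiftSeq {α : Type*} (u : ℕ → α) : ℕ → α := fun n => u (n + 1)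

/-- The restriction `(ω(x))_{x ≥ 0}` of an environment to the nonnegative sites. -/
def restrictNN (ω : CEnv) : ℕ → ℕ → ℝ := fun x => ω (x : ℤ)

/-- `(ω(x))_{x ≥ 0}` is stationary under `Pr`: its law is invariant under the shift. -/
def IsStationaryEnv (Pr : Measure CEnv) : Prop :=
  MeasurePreserving shiftSeq (Pr.map restrictNN) (Pr.map restrictNN)

/-- `(ω(x))_{x ≥ 0}` is stationary and ergodic under `Pr`. -/
def IsStatErgEnv (Pr : Measure CEnv) : Prop :=
  Ergodic shiftSeq (Pr.map restrictNN)

/-- The process `ξ_k = ((ω(x+k))_{x≥0}, (X_{τ_{k,m}} − k)_{m≥0})` consisting of the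
environment to the right of `k` and the trajectory at sites `≥ k`, recentered at `k`. -/
def xiProc (p : CEnv × (ℕ → ℤ)) (k : ℕ) : (ℕ → ℕ → ℝ) × (ℕ → ℤ) :=
  (fun x : ℕ => p.1 ((x : ℤ) + (k : ℤ)), fun m => obsSeq (k : ℤ) p.2 m - (k : ℤ))

/-- The number of visits of the path `Y` to the site `k` at times `< n`. -/
def visits (Y : ℕ → ℤ) (k : ℤ) (n : ℕ) : ℕ :=
  ((Finset.range n).filter fun m => Y m = k).card

lemma visits_zero (Y : ℕ → ℤ) (k : ℤ) : visits Y k 0 = 0 := by simp [visits]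

lemma visits_succ (Y : ℕ → ℤ) (k : ℤ) (n : ℕ) :
    visits Y k (n + 1) = visits Y k n + if Y n = k then 1 else 0 := by
  unfold visits
  rw [Finset.range_add_one, Finset.filter_insert]
  split_ifs <;> simp

lemma visits_eq_zero_iff (Y : ℕ → ℤ) (k : ℤ) (n : ℕ) :
    visits Y k n = 0 ↔ ∀ m < n, Y m ≠ k := by
  simp [visits, Finset.filter_eq_empty_iff]

lemma le_of_forall_visits_le {Y Z : ℕ → ℤ} {n n' : ℕ}
    (h : ∀ k, visits Y k n ≤ visits Z k n') : n ≤ n' := by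
  have key : ∀ (X : ℕ → ℤ) (j : ℕ) (s : Finset ℤ), (∀ m < j, X m ∈ s) →
      j = ∑ k ∈ s, visits X k j := by
    intro X j s hs
    have := Finset.card_eq_sum_card_fiberwise (f := X) (s := Finset.range j) (t := s)
      (fun m hm => hs m (by simpa using hm))
    simpa [visits] using this
  have hY := key Y n ((Finset.range n).image Y ∪ (Finset.range n').image Z) (fun m hm =>
    Finset.mem_union_left _ (Finset.mem_image_of_mem _ (Finset.mem_range.2 hm)))
  have hZ := key Z n' ((Finset.range n).image Y ∪ (Finset.range n').image Z) (fun m hm =>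
    Finset.mem_union_right _ (Finset.mem_image_of_mem _ (Finset.mem_range.2 hm)))
  exact hY.trans_le ((Finset.sum_le_sum fun k _ => h k).trans_eq hZ.symm)

open Classical in
/-- `Y` is the walk started at `y` that, on its `(i+1)`-st visit to the site `k`, steps to the
right if the arrow `a k i` points to the right and to the left otherwise. -/
def IsArrowWalk (a : ℤ → ℕ → Prop) (y : ℤ) (Y : ℕ → ℤ) : Prop :=
  Y 0 = y ∧ ∀ n, Y (n + 1) = Y n + if a (Y n) (prevVisits Y n) then 1 else -1

open Classical in
/-- Conservation of the flow through the edge between `k` and `k + 1`. -/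
lemma IsArrowWalk.flow {a : ℤ → ℕ → Prop} {y : ℤ} {Y : ℕ → ℤ} (h : IsArrowWalk a y Y)
    (k : ℤ) (n : ℕ) :
    (Nat.count (a k) (visits Y k n) : ℤ)
        - Nat.count (fun i => ¬ a (k + 1) i) (visits Y (k + 1) n)
      = (if k + 1 ≤ Y n then 1 else 0) - if k + 1 ≤ y then 1 else 0 := by
  induction n with
  | zero => simp [visits_zero, h.1]
  | succ n ih =>
    have hs := h.2 n
    change Y (n + 1) = Y n + if a (Y n) (visits Y (Y n) n) then 1 else -1 at hs
    rw [visits_succ, visits_succ]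
    by_cases h1 : Y n = k
    · have h2 : Y n ≠ k + 1 := by omega
      rw [if_pos h1, if_neg h2, Nat.count_succ]
      rw [h1] at hs ih
      split_ifs at hs ih ⊢ <;> push_cast <;> simp only [add_zero] at * <;>
        omega
    · rw [if_neg h1]
      by_cases h2 : Y n = k + 1
      · rw [if_pos h2, Nat.count_succ]
        rw [h2] at hs ih
        split_ifs at hs ih ⊢ <;> push_cast <;> simp only [add_zero] at * <;>
          omega
      · rw [if_neg h2]
        split_ifs at hs ih ⊢ <;> simp only [add_zero] at * <;> omega

/-- Least action principle: up to the hitting time of `z`, the walk with more arrows to the right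
visits every site at most as often as the walk with fewer arrows to the right. -/
lemma IsArrowWalk.visits_le {a₁ a₂ : ℤ → ℕ → Prop} {y z : ℤ} {Y₁ Y₂ : ℕ → ℤ}
    (h₁ : IsArrowWalk a₁ y Y₁) (h₂ : IsArrowWalk a₂ y Y₂) (ha : ∀ k i, a₁ k i → a₂ k i)
    (hz : y ≤ z) {n : ℕ} (hn : Y₁ n = z) (n' : ℕ) (hn' : ∀ m < n', Y₂ m ≠ z) (k : ℤ) :
    visits Y₂ k n' ≤ visits Y₁ k n := by
  classical
  induction n' generalizing k with
  | zero => simp [visits_zero]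
  | succ n' ih =>
    replace ih := ih fun m hm => hn' m (by omega)
    rw [visits_succ]
    by_cases hk : Y₂ n' = k
    · rw [if_pos hk]
      by_contra! hlt
      have heq : visits Y₂ k n' = visits Y₁ k n := by
        have := ih k
        omega
      have hkz : k < z := by
        have hne : Y₂ n' ≠ z := hn' n' (by omega)
        by_contra! hge
        have hf := h₂.flow z n'
        have h0 : visits Y₂ z n' = 0 :=
          (visits_eq_zero_iff _ _ _).2 fun m hm => hn' m (by omega)
        rw [h0, Nat.count_zero, if_pos (by omega), if_neg (by omega)] at hf
        omega
      have hf₁ := h₁.flow k n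
      have hf₂ := h₂.flow k n'
      have hR := Nat.count_mono_left (n := visits Y₁ k n) fun i _ => ha k i
      have hL : Nat.count (fun i => ¬ a₂ (k + 1) i) (visits Y₂ (k + 1) n')
          ≤ Nat.count (fun i => ¬ a₁ (k + 1) i) (visits Y₁ (k + 1) n) :=
        (Nat.count_monotone _ (ih (k + 1))).trans
          (Nat.count_mono_left fun i _ hi h => hi (ha _ i h))
      rw [hn, if_pos (show k + 1 ≤ z by omega)] at hf₁
      rw [hk, if_neg (show ¬ k + 1 ≤ k by omega), heq] at hf₂
      omega
    · simpa [hk] using ih k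

lemma IsArrowWalk.hits_of_hits {a₁ a₂ : ℤ → ℕ → Prop} {y z : ℤ} {Y₁ Y₂ : ℕ → ℤ}
    (h₁ : IsArrowWalk a₁ y Y₁) (h₂ : IsArrowWalk a₂ y Y₂) (ha : ∀ k i, a₁ k i → a₂ k i)
    (hz : y ≤ z) (S : Set ℤ) {n : ℕ} (hn : Y₁ n = z) (hS : ∀ m < n, Y₁ m ∉ S) :
    ∃ n' ≤ n, Y₂ n' = z ∧ ∀ m < n', Y₂ m ∉ S := by
  classical
  have hle := h₁.visits_le h₂ ha hz hn
  have hex : ∃ n', Y₂ n' = z := by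
    by_contra! hne
    have := le_of_forall_visits_le (hle (n + 1) fun m _ => hne m)
    omega
  have hmin : ∀ m < Nat.find hex, Y₂ m ≠ z := fun m hm => Nat.find_min hex hm
  refine ⟨Nat.find hex, le_of_forall_visits_le (hle _ hmin), Nat.find_spec hex, ?_⟩
  intro m hm hmS
  have h0 : visits Y₁ (Y₂ m) n = 0 :=
    (visits_eq_zero_iff _ _ _).2 fun j hj hEq => hS j hj (hEq ▸ hmS)
  have h0' : visits Y₂ (Y₂ m) (Nat.find hex) = 0 := Nat.le_zero.1 (h0 ▸ hle _ hmin _)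
  exact (visits_eq_zero_iff _ _ _).1 h0' m hm rfl

lemma IsArrowWalk.neg {a : ℤ → ℕ → Prop} {y : ℤ} {Y : ℕ → ℤ} (h : IsArrowWalk a y Y) :
    IsArrowWalk (fun k i => ¬ a (-k) i) (-y) (fun n => -Y n) := by
  refine ⟨by simp [h.1], fun n => ?_⟩
  have hv : prevVisits (fun n => -Y n) n = prevVisits Y n := by simp [prevVisits]
  rw [hv]
  simp only [neg_neg, h.2 n]
  by_cases ha : a (Y n) (prevVisits Y n)
  · simp [ha]; ring
  · simp [ha]; ring

lemma IsArrowWalk.hits_of_hits_left {a₁ a₂ : ℤ → ℕ → Prop} {y x : ℤ} {Y₁ Y₂ : ℕ → ℤ}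
    (h₁ : IsArrowWalk a₁ y Y₁) (h₂ : IsArrowWalk a₂ y Y₂) (ha : ∀ k i, a₁ k i → a₂ k i)
    (hx : x ≤ y) (S : Set ℤ) {n : ℕ} (hn : Y₂ n = x) (hS : ∀ m < n, Y₂ m ∉ S) :
    ∃ n' ≤ n, Y₁ n' = x ∧ ∀ m < n', Y₁ m ∉ S := by
  obtain ⟨n', hle, h, h'⟩ := h₂.neg.hits_of_hits h₁.neg (fun k i hi h => hi (ha _ i h))
    (neg_le_neg hx) ((fun k => -k) ⁻¹' S) (n := n) (by simp [hn]) (by simpa using hS)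
  exact ⟨n', hle, by simpa using h, by simpa using h'⟩

/-- Current position and visit counts of the walk following the arrows `a`. -/
def arrowState (a : ℤ → ℕ → Prop) (y : ℤ) : ℕ → ℤ × (ℤ → ℕ)
  | 0 => (y, fun _ => 0)
  | n + 1 =>
    let s := arrowState a y n
    open Classical in
    (s.1 + (if a s.1 (s.2 s.1) then 1 else -1), Function.update s.2 s.1 (s.2 s.1 + 1))

/-- The walk started at `y` following the arrows `a`. -/
def arrowWalk (a : ℤ → ℕ → Prop) (y : ℤ) (n : ℕ) : ℤ := (arrowState a y n).1

lemma arrowState_snd (a : ℤ → ℕ → Prop) (y : ℤ) (n : ℕ) (k : ℤ) :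
    (arrowState a y n).2 k = visits (arrowWalk a y) k n := by
  induction n with
  | zero => simp [arrowState, visits_zero]
  | succ n ih =>
    rw [visits_succ, ← ih]
    simp only [arrowState, arrowWalk, Function.update_apply]
    by_cases h : k = (arrowState a y n).1
    · simp [h]
    · simp [h, Ne.symm h]

lemma isArrowWalk_arrowWalk (a : ℤ → ℕ → Prop) (y : ℤ) : IsArrowWalk a y (arrowWalk a y) := by
  refine ⟨rfl, fun n => ?_⟩
  have hv : prevVisits (arrowWalk a y) n = (arrowState a y n).2 (arrowWalk a y n) :=
    (arrowState_snd a y n _).symm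
  rw [hv]
  rfl

lemma prevVisits_congr {x x' : ℕ → ℤ} {n : ℕ} (h : ∀ m ≤ n, x m = x' m) :
    prevVisits x n = prevVisits x' n := by
  unfold prevVisits
  congr 1
  refine Finset.filter_congr fun m hm => ?_
  rw [h m (Finset.mem_range.1 hm).le, h n le_rfl]

open Classical in
lemma IsArrowWalk.agree_iff {a : ℤ → ℕ → Prop} {y : ℤ} {Y : ℕ → ℤ} (h : IsArrowWalk a y Y)
    (x : ℕ → ℤ) (n : ℕ) :
    (∀ m ≤ n, Y m = x m) ↔
      x 0 = y ∧ ∀ m < n, x (m + 1) = x m + if a (x m) (prevVisits x m) then 1 else -1 := by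
  induction n with
  | zero => simp [h.1, eq_comm]
  | succ n ih =>
    constructor
    · intro hY
      have hx := (ih.1 fun m hm => hY m (by omega))
      refine ⟨hx.1, fun m hm => ?_⟩
      have := h.2 m
      rwa [hY _ (by omega), hY m (by omega),
        prevVisits_congr (fun j hj => hY j (by omega))] at this
    · rintro ⟨h0, hx⟩ m hm
      have hY := ih.2 ⟨h0, fun m hm => hx m (by omega)⟩
      rcases Nat.lt_or_ge n m with hlt | hge
      · obtain rfl : m = n + 1 := by omega
        rw [h.2 n, hx n (by omega), hY n le_rfl, prevVisits_congr hY]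
      · exact hY m hge

lemma injective_site_prevVisits (x : ℕ → ℤ) :
    Function.Injective fun m => (x m, prevVisits x m) := by
  have key : ∀ m n, m < n → x m = x n → prevVisits x m < prevVisits x n := by
    intro m n hmn hx
    refine Finset.card_lt_card (Finset.ssubset_iff_of_subset ?_ |>.2 ⟨m, ?_, ?_⟩)
    · intro j hj
      simp only [Finset.mem_filter, Finset.mem_range] at hj ⊢
      exact ⟨by omega, hj.2.trans hx⟩
    · simp [hmn, hx]
    · simp
  intro m n h
  simp only [Prod.mk.injEq] at h
  rcases lt_trichotomy m n with hlt | heq | hgt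
  · have := key m n hlt h.1
    omega
  · exact heq
  · have := key n m hgt h.1.symm
    omega

/-- The sets of paths with a prescribed initial segment. -/
def pathCylinders : Set (Set (ℕ → ℤ)) :=
  {s | ∃ (x : ℕ → ℤ) (n : ℕ), s = {Y | ∀ m ≤ n, Y m = x m}}

lemma isPiSystem_pathCylinders : IsPiSystem pathCylinders := by
  rintro _ ⟨x, n, rfl⟩ _ ⟨x', n', rfl⟩ ⟨Y, hY, hY'⟩
  refine ⟨Y, max n n', ?_⟩
  ext Z
  simp only [mem_inter_iff, mem_ofPred_eq] at hY hY' ⊢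
  constructor
  · rintro ⟨hZ, hZ'⟩ m hm
    rcases le_max_iff.1 hm with h | h
    · rw [hZ m h, hY m h]
    · rw [hZ' m h, hY' m h]
  · intro hZ
    exact ⟨fun m hm => (hZ m (le_max_of_le_left hm)).trans (hY m hm),
      fun m hm => (hZ m (le_max_of_le_right hm)).trans (hY' m hm)⟩

lemma measurableSet_bforall {α : Type*} [MeasurableSpace α] {q : ℕ → Prop} {p : ℕ → α → Prop}
    (h : ∀ m, MeasurableSet {a | p m a}) : MeasurableSet {a | ∀ m, q m → p m a} := by
  have : {a | ∀ m, q m → p m a} = ⋂ m, ⋂ (_ : q m), {a | p m a} := by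
    ext
    simp
  rw [this]
  exact MeasurableSet.iInter fun m => MeasurableSet.iInter fun _ => h m

lemma generateFrom_pathCylinders :
    (MeasurableSpace.pi : MeasurableSpace (ℕ → ℤ)) =
      MeasurableSpace.generateFrom pathCylinders := by
  apply le_antisymm
  · refine iSup_le fun n => ?_
    rw [← measurable_iff_comap_le]
    refine @measurable_to_countable' _ _ _ _ (MeasurableSpace.generateFrom pathCylinders) _
      fun k => ?_
    have : (fun Y : ℕ → ℤ => Y n) ⁻¹' {k} =
        ⋃ p : {p : Fin (n + 1) → ℤ // p (Fin.last n) = k}, {Y : ℕ → ℤ | ∀ m ≤ n,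
          Y m = (fun m => if h : m < n + 1 then p.1 ⟨m, h⟩ else 0) m} := by
      ext Y
      simp only [mem_preimage, mem_singleton_iff, mem_iUnion, mem_ofPred_eq]
      constructor
      · intro hY
        refine ⟨⟨fun i => Y i, by simpa using hY⟩, fun m hm => ?_⟩
        simp [Nat.lt_succ_of_le hm]
      · rintro ⟨⟨p, hp⟩, hY⟩
        rw [hY n le_rfl, dif_pos n.lt_succ_self]
        exact hp
    rw [this]
    exact MeasurableSet.iUnion fun p => MeasurableSpace.measurableSet_generateFrom ⟨_, _, rfl⟩
  · refine MeasurableSpace.generateFrom_le ?_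
    rintro _ ⟨x, n, rfl⟩
    exact measurableSet_bforall fun m =>
      (measurableSet_singleton (x m)).preimage (measurable_pi_apply m)

lemma IsERWLaw.eq {ω : CEnv} {y : ℤ} {P Q : Measure (ℕ → ℤ)} (hP : IsERWLaw ω y P)
    (hQ : IsERWLaw ω y Q) : P = Q := by
  have := hP.1
  have := hQ.1
  refine ext_of_generate_finite _ generateFrom_pathCylinders isPiSystem_pathCylinders ?_
    (by simp)
  rintro _ ⟨x, n, rfl⟩
  rw [hP.2, hQ.2]

/-- Independent uniform variables attached to the cookies. -/
def cookieMeasure : Measure (ℤ × ℕ → unitInterval) := Measure.infinitePi fun _ => volume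

instance : IsProbabilityMeasure cookieMeasure := by
  unfold cookieMeasure
  infer_instance

/-- The walk in the environment `ω` driven by the uniform variables `U`. -/
def coupledWalk (ω : CEnv) (y : ℤ) (U : ℤ × ℕ → unitInterval) : ℕ → ℤ :=
  arrowWalk (fun k i => (U (k, i) : ℝ) ≤ ω k i) y

open Classical in
/-- Values of the uniform variable for which the step of `x` at time `m` is made. -/
def stepSet (ω : CEnv) (x : ℕ → ℤ) (m : ℕ) : Set unitInterval :=
  {u | x (m + 1) = x m + if (u : ℝ) ≤ ω (x m) (prevVisits x m) then 1 else -1}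

lemma stepSet_eq (ω : CEnv) (x : ℕ → ℤ) (m : ℕ) : stepSet ω x m =
    if x (m + 1) = x m + 1 then {u : unitInterval | (u : ℝ) ≤ ω (x m) (prevVisits x m)}
    else if x (m + 1) = x m - 1 then {u : unitInterval | ω (x m) (prevVisits x m) < u} else ∅ := by
  refine Set.ext fun u => ?_
  unfold stepSet
  split_ifs with h1 h2 <;> simp only [mem_ofPred_eq, mem_empty_iff_false] <;>
    split_ifs with h3 <;> grind

lemma measurableSet_stepSet (ω : CEnv) (x : ℕ → ℤ) (m : ℕ) :
    MeasurableSet (stepSet ω x m) := by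
  rw [stepSet_eq]
  split_ifs
  · exact measurableSet_le measurable_subtype_coe measurable_const
  · exact measurableSet_lt measurable_const measurable_subtype_coe
  · exact MeasurableSet.empty

lemma volume_stepSet {ω : CEnv} (hω : IsCookieEnv ω) (x : ℕ → ℤ) (m : ℕ) :
    volume (stepSet ω x m) = ENNReal.ofReal (stepProb ω x m) := by
  obtain ⟨h0, h1⟩ := hω (x m) (prevVisits x m)
  rw [stepSet_eq, stepProb]
  have h0' : 0 ≤ ω (x m) (prevVisits x m) := by linarith
  split_ifs
  · have : {u : unitInterval | (u : ℝ) ≤ ω (x m) (prevVisits x m)} =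
      Set.Iic ⟨ω (x m) (prevVisits x m), h0', h1⟩ := rfl
    rw [this]
    simp
  · have : {u : unitInterval | ω (x m) (prevVisits x m) < u} =
      Set.Ioi ⟨ω (x m) (prevVisits x m), h0', h1⟩ := rfl
    rw [this]
    simp
  · simp

lemma coupledWalk_agree (ω : CEnv) (y : ℤ) (x : ℕ → ℤ) (n : ℕ) :
    {U | ∀ m ≤ n, coupledWalk ω y U m = x m} =
      {U | x 0 = y ∧ ∀ m < n, U (x m, prevVisits x m) ∈ stepSet ω x m} := by
  ext U
  exact (isArrowWalk_arrowWalk _ y).agree_iff x n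

lemma measurable_coupledWalk (ω : CEnv) (y : ℤ) : Measurable (coupledWalk ω y) := by
  rw [generateFrom_pathCylinders]
  refine measurable_generateFrom ?_
  rintro _ ⟨x, n, rfl⟩
  rw [preimage_ofPred_eq, coupledWalk_agree]
  refine MeasurableSet.inter (MeasurableSet.const _) ?_
  exact measurableSet_bforall fun m =>
    (measurableSet_stepSet ω x m).preimage (measurable_pi_apply _)

lemma cookieMeasure_steps {ω : CEnv} (hω : IsCookieEnv ω) (x : ℕ → ℤ) (n : ℕ) :
    cookieMeasure {U | ∀ m < n, U (x m, prevVisits x m) ∈ stepSet ω x m} =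
      ENNReal.ofReal (∏ m ∈ Finset.range n, stepProb ω x m) := by
  classical
  have hinj := injective_site_prevVisits x
  set f : ℕ → ℤ × ℕ := fun m => (x m, prevVisits x m) with hf
  let t : ℤ × ℕ → Set unitInterval := fun i => ⋂ m, ⋂ (_ : f m = i), stepSet ω x m
  have ht : ∀ m, t (f m) = stepSet ω x m := fun m => by
    ext u
    simp only [t, mem_iInter]
    exact ⟨fun h => h m rfl, fun h j hj => hinj hj ▸ h⟩
  have hset : {U : ℤ × ℕ → unitInterval | ∀ m < n, U (f m) ∈ stepSet ω x m} =
      Set.pi ((Finset.range n).image f) t := by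
    ext U
    simp [Set.mem_pi, ht]
  have hnn : ∀ m, 0 ≤ stepProb ω x m := fun m => by
    obtain ⟨h0, h1⟩ := hω (x m) (prevVisits x m)
    unfold stepProb
    split_ifs <;> linarith
  change cookieMeasure {U : ℤ × ℕ → unitInterval | ∀ m < n, U (f m) ∈ stepSet ω x m} = _
  rw [hset, cookieMeasure, Measure.infinitePi_pi, Finset.prod_image fun _ _ _ _ h => hinj h,
    ENNReal.ofReal_prod_of_nonneg fun m _ => hnn m]
  · exact Finset.prod_congr rfl fun m _ => by rw [ht, volume_stepSet hω]
  · intro i _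
    exact MeasurableSet.iInter fun m => MeasurableSet.iInter fun _ => measurableSet_stepSet ω x m

lemma isERWLaw_coupledWalk {ω : CEnv} (hω : IsCookieEnv ω) (y : ℤ) :
    IsERWLaw ω y (cookieMeasure.map (coupledWalk ω y)) := by
  have hm := measurable_coupledWalk ω y
  refine ⟨Measure.isProbabilityMeasure_map hm.aemeasurable, fun x n => ?_⟩
  rw [Measure.map_apply hm, preimage_ofPred_eq, coupledWalk_agree, cylProb]
  · by_cases h : x 0 = y
    · simpa [h] using cookieMeasure_steps hω x n
    · simp [h]
  · rw [generateFrom_pathCylinders]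
    exact MeasurableSpace.measurableSet_generateFrom ⟨x, n, rfl⟩

lemma Te_lt_iff (k : EReal) (Y : ℕ → ℤ) (b : ℕ∞) :
    Te k Y < b ↔ ∃ n : ℕ, (n : ℕ∞) < b ∧ ((Y n : ℝ) : EReal) = k := by
  simp only [Te, sInf_lt_iff, mem_ofPred_eq]
  constructor
  · rintro ⟨_, ⟨n, rfl, h⟩, hb⟩
    exact ⟨n, hb, h⟩
  · rintro ⟨n, hb, h⟩
    exact ⟨n, ⟨n, rfl, h⟩, hb⟩

lemma le_Te_iff (k : EReal) (Y : ℕ → ℤ) (b : ℕ∞) :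
    b ≤ Te k Y ↔ ∀ n : ℕ, (n : ℕ∞) < b → ((Y n : ℝ) : EReal) ≠ k := by
  rw [← not_lt, Te_lt_iff]
  push Not
  rfl

lemma lt_Te_iff (k : EReal) (Y : ℕ → ℤ) (n : ℕ) :
    (n : ℕ∞) < Te k Y ↔ ∀ m ≤ n, ((Y m : ℝ) : EReal) ≠ k := by
  rw [← ENat.add_one_le_iff (ENat.natCast_ne_top n), le_Te_iff]
  refine forall_congr' fun m => ?_
  norm_cast
  rw [Nat.lt_succ_iff]

lemma exists_eq_Te {k : EReal} {Y : ℕ → ℤ} (h : Te k Y ≠ ⊤) :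
    ∃ n : ℕ, (n : ℕ∞) = Te k Y ∧ ((Y n : ℝ) : EReal) = k := by
  obtain ⟨n, -, hn⟩ := (Te_lt_iff k Y ⊤).1 (lt_top_iff_ne_top.2 h)
  exact csInf_mem (s := {t : ℕ∞ | ∃ n : ℕ, (n : ℕ∞) = t ∧ ((Y n : ℝ) : EReal) = k})
    ⟨n, n, rfl, hn⟩

lemma Te_le_min_iff (x z : EReal) (Y : ℕ → ℤ) (t : ℕ) :
    Te z Y ≤ min (Te x Y) t ↔
      ∃ n ≤ t, ((Y n : ℝ) : EReal) = z ∧ ∀ m < n, ((Y m : ℝ) : EReal) ≠ x := by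
  constructor
  · intro h
    obtain ⟨hx, ht⟩ := le_min_iff.1 h
    obtain ⟨n, hn, hz⟩ := exists_eq_Te (ht.trans_lt (ENat.natCast_lt_top t)).ne
    rw [← hn] at hx ht
    exact ⟨n, by exact_mod_cast ht, hz, fun m hm =>
      (le_Te_iff x Y n).1 hx m (by exact_mod_cast hm)⟩
  · rintro ⟨n, hn, hz, hx⟩
    have hT : Te z Y ≤ n := sInf_le ⟨n, rfl, hz⟩
    exact le_min (hT.trans ((le_Te_iff x Y n).2 fun m hm => hx m (by exact_mod_cast hm)))
      (hT.trans (by exact_mod_cast hn))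

lemma Te_le_Te_iff (x z : EReal) (Y : ℕ → ℤ) :
    Te z Y ≤ Te x Y ↔
      ¬ ∃ n : ℕ, ((Y n : ℝ) : EReal) = x ∧ ∀ m ≤ n, ((Y m : ℝ) : EReal) ≠ z := by
  rw [← not_lt, Te_lt_iff]
  simp only [lt_Te_iff, and_comm]

lemma measurableSet_Te_le_min (x z : EReal) (t : ℕ∞) :
    MeasurableSet {Y : ℕ → ℤ | Te z Y ≤ min (Te x Y) t} := by
  have hm : ∀ (n : ℕ) (k : EReal), MeasurableSet {Y : ℕ → ℤ | ((Y n : ℝ) : EReal) = k} :=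
    fun n k =>
    (MeasurableSet.of_discrete (s := {j : ℤ | ((j : ℝ) : EReal) = k})).preimage
      (measurable_pi_apply n)
  induction t using ENat.recTopCoe with
  | top =>
    simp only [min_top_right, Te_le_Te_iff]
    refine MeasurableSet.compl (s := {Y : ℕ → ℤ | ∃ n : ℕ, _}) ?_
    rw [ofPred_exists]
    refine MeasurableSet.iUnion fun n => (hm n x).inter ?_
    exact measurableSet_bforall fun m => (hm m z).compl
  | coe t =>
    simp only [Te_le_min_iff]
    rw [ofPred_exists]
    refine MeasurableSet.iUnion fun n => (MeasurableSet.const _).inter ((hm n z).inter ?_)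
    exact measurableSet_bforall fun m => (hm m x).compl

lemma IsArrowWalk.Te_le_min {a₁ a₂ : ℤ → ℕ → Prop} {y : ℤ} {Y₁ Y₂ : ℕ → ℤ}
    (h₁ : IsArrowWalk a₁ y Y₁) (h₂ : IsArrowWalk a₂ y Y₂) (ha : ∀ k i, a₁ k i → a₂ k i)
    {x z : EReal} (hx : x ≤ ((y : ℝ) : EReal)) (hz : ((y : ℝ) : EReal) ≤ z) {t : ℕ∞}
    (h : Te z Y₁ ≤ min (Te x Y₁) t) : Te z Y₂ ≤ min (Te x Y₂) t := by
  induction t using ENat.recTopCoe with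
  | top =>
    rw [min_top_right, Te_le_Te_iff] at h ⊢
    contrapose! h
    obtain ⟨n, rfl, hne⟩ := h
    obtain ⟨n', -, hn', hS⟩ := h₁.hits_of_hits_left h₂ ha (x := Y₂ n) (by exact_mod_cast hx)
      {k | ((k : ℝ) : EReal) = z} rfl (fun m hm => hne m hm.le)
    refine ⟨n', by rw [hn'], fun m hm => ?_⟩
    rcases hm.lt_or_eq with hlt | rfl
    · exact hS m hlt
    · rw [hn']
      exact hne n le_rfl
  | coe t =>
    rw [Te_le_min_iff] at h ⊢
    obtain ⟨n, hnt, rfl, hne⟩ := h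
    obtain ⟨n', hle, hn', hS⟩ := h₁.hits_of_hits h₂ ha (z := Y₁ n) (by exact_mod_cast hz)
      {k | ((k : ℝ) : EReal) = x} rfl hne
    exact ⟨n', hle.trans hnt, by rw [hn'], hS⟩

/-- Lemma 19, monotonicity w.r.t. the environment. If `ω₁ ≤ ω₂`
pointwise, `−∞ ≤ x ≤ y ≤ z ≤ ∞` (with `y ∈ ℤ`) and `t ∈ ℕ ∪ {∞}`, then
`P_{y,ω₁}[T_z ≤ T_x ∧ t] ≤ P_{y,ω₂}[T_z ≤ T_x ∧ t]`. -/
theorem erw_monotone_environment (ω₁ ω₂ : CEnv)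
    (hω₁ : IsCookieEnv ω₁) (hω₂ : IsCookieEnv ω₂)
    (hle : ∀ z i, ω₁ z i ≤ ω₂ z i)
    (x z : EReal) (y : ℤ)
    (hx : x ≤ ((y : ℝ) : EReal)) (hz : ((y : ℝ) : EReal) ≤ z)
    (t : ℕ∞)
    (P₁ P₂ : Measure (ℕ → ℤ)) (hP₁ : IsERWLaw ω₁ y P₁) (hP₂ : IsERWLaw ω₂ y P₂) :
    P₁ {Y | Te z Y ≤ min (Te x Y) t} ≤ P₂ {Y | Te z Y ≤ min (Te x Y) t} := by
  have hE := measurableSet_Te_le_min x z t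
  rw [hP₁.eq (isERWLaw_coupledWalk hω₁ y), hP₂.eq (isERWLaw_coupledWalk hω₂ y),
    Measure.map_apply (measurable_coupledWalk ω₁ y) hE,
    Measure.map_apply (measurable_coupledWalk ω₂ y) hE]
  exact measure_mono fun U hU => (isArrowWalk_arrowWalk _ y).Te_le_min
    (isArrowWalk_arrowWalk _ y) (fun k i h => h.trans (hle k i)) hx hz hU

end
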